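/- Let Θ and 𝒴 be measurable spaces, κ a Markov kernel from Θ to 𝒴, p a probability measure on Θ, and ε ≥ 0. Let A_ε(p) be the set of probability measures q on Θ with q ≪ p and KL(q ‖ p) ≤ ε. Assume I_aff(q;p) is finite for all q ∈ A_ε(p). Then the robust expected information gain I_ε(p) = inf_{q ∈ A_ε(p)} I_aff(q;p) and the true robust expected information gain I_ε^true(p) = inf_{q ∈ A_ε(p)} I(q) satisfy 0 ≤ I_ε(p) − I_ε^true(p) ≤ ε. -/

import Mathlib

open MeasureTheory ProbabilityTheory Real Classical
open scoped ENNReal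

/-- The Kullback–Leibler divergence `KL(μ ‖ ν) = ∫ log (dμ/dν) dμ`, with value `∞`
unless `μ` is absolutely continuous w.r.t. `ν` and the log-likelihood ratio is integrable. -/
noncomputable def klDiv {α : Type*} [MeasurableSpace α] (μ ν : Measure α) : ℝ≥0∞ :=
  if μ ≪ ν ∧ Integrable (llr μ ν) μ then ENNReal.ofReal (∫ x, llr μ ν x ∂μ) else ⊤

/-- The marginal `q∘κ` on `𝒴` of a prior `q` on `Θ` under the likelihood kernel `κ`,
given by `(q∘κ)(A) = ∫ κ(θ)(A) dq(θ)`. -/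
noncomputable def marg {Θ 𝒴 : Type*} [MeasurableSpace Θ] [MeasurableSpace 𝒴]
    (κ : Kernel Θ 𝒴) (q : Measure Θ) : Measure 𝒴 :=
  q.bind κ

/-- The expected information gain of prior `q`: `I(q) = ∫ KL(κ(θ) ‖ q∘κ) dq(θ)`. -/
noncomputable def EIG {Θ 𝒴 : Type*} [MeasurableSpace Θ] [MeasurableSpace 𝒴]
    (κ : Kernel Θ 𝒴) (q : Measure Θ) : ℝ≥0∞ :=
  ∫⁻ θ, klDiv (κ θ) (marg κ q) ∂q

/-- The affine approximation of the expected information gain at reference prior `p`: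
`I_aff(q;p) = ∫ KL(κ(θ) ‖ p∘κ) dq(θ)`. -/
noncomputable def EIGaff {Θ 𝒴 : Type*} [MeasurableSpace Θ] [MeasurableSpace 𝒴]
    (κ : Kernel Θ 𝒴) (q p : Measure Θ) : ℝ≥0∞ :=
  ∫⁻ θ, klDiv (κ θ) (marg κ p) ∂q

open InformationTheory in
lemma klDiv_eq_informationTheory_klDiv {α : Type*} [MeasurableSpace α] (μ ν : Measure α)
    [IsProbabilityMeasure μ] [IsProbabilityMeasure ν] :
    _root_.klDiv μ ν = InformationTheory.klDiv μ ν := by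
  rw [_root_.klDiv]
  split_ifs with h
  · simp [InformationTheory.klDiv_of_ac_of_integrable h.1 h.2]
  · exact (klDiv_eq_top_iff.2 fun h₁ h₂ => h ⟨h₁, h₂⟩).symm

lemma integral_llr_nonneg {α : Type*} [MeasurableSpace α] {μ ν : Measure α}
    [IsProbabilityMeasure μ] [IsProbabilityMeasure ν] (h : μ ≪ ν)
    (hi : Integrable (llr μ ν) μ) : 0 ≤ ∫ x, llr μ ν x ∂μ := by
  simpa using InformationTheory.integral_llr_add_sub_measure_univ_nonneg h hi

lemma llr_add_llr {α : Type*} [MeasurableSpace α] {μ ν ρ : Measure α}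
    [SigmaFinite μ] [SigmaFinite ν] [SigmaFinite ρ] (hμν : μ ≪ ν) (hνρ : ν ≪ ρ) :
    llr μ ν + llr ν ρ =ᵐ[μ] llr μ ρ := by
  filter_upwards [(hμν.trans hνρ).ae_le (Measure.rnDeriv_mul_rnDeriv (κ := ρ) hμν),
    Measure.rnDeriv_pos hμν, hμν.ae_le (Measure.rnDeriv_lt_top μ ν),
    hμν.ae_le (Measure.rnDeriv_pos hνρ),
    (hμν.trans hνρ).ae_le (Measure.rnDeriv_lt_top ν ρ)] with x h h₁ h₂ h₃ h₄
  rw [Pi.mul_apply] at h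
  rw [Pi.add_apply, llr, llr, llr, ← h, ENNReal.toReal_mul, Real.log_mul
    (ENNReal.toReal_pos h₁.ne' h₂.ne).ne' (ENNReal.toReal_pos h₃.ne' h₄.ne).ne']

lemma absolutelyContinuous_of_ae_rnDeriv_ne_zero {α : Type*} [MeasurableSpace α]
    {μ ν ρ : Measure α} [SigmaFinite ν] [SigmaFinite ρ] (hμρ : μ ≪ ρ) (hνρ : ν ≪ ρ)
    (h : ∀ᵐ x ∂μ, ν.rnDeriv ρ x ≠ 0) : μ ≪ ν := by
  intro s hs
  rw [← Measure.withDensity_rnDeriv_eq ν ρ hνρ,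
    withDensity_apply_eq_zero (Measure.measurable_rnDeriv ν ρ)] at hs
  refine measure_mono_null (t := {x | ν.rnDeriv ρ x ≠ 0} ∩ s ∪ {x | ¬ ν.rnDeriv ρ x ≠ 0}) ?_
    (measure_union_null (hμρ hs) h)
  intro x hx
  by_cases hx0 : ν.rnDeriv ρ x ≠ 0
  · exact Or.inl ⟨hx0, hx⟩
  · exact Or.inr hx0

lemma klDiv_add_ofReal_neg_integral_llr {α : Type*} [MeasurableSpace α] {μ ν ρ : Measure α}
    [IsProbabilityMeasure μ] [IsProbabilityMeasure ν] [IsProbabilityMeasure ρ]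
    (hνρ : ν ≪ ρ) (hμν : μ ≪ ρ → μ ≪ ν) (hi : Integrable (llr ν ρ) μ) :
    klDiv μ ρ + ENNReal.ofReal (-∫ x, llr ν ρ x ∂μ) =
      klDiv μ ν + ENNReal.ofReal (∫ x, llr ν ρ x ∂μ) := by
  by_cases h : μ ≪ ν
  swap
  · simp [klDiv, h, mt hμν h]
  have hadd := llr_add_llr h hνρ
  by_cases hllr : Integrable (llr μ ν) μ
  · have hllr' : Integrable (llr μ ρ) μ := (hllr.add hi).congr hadd
    have heq : ∫ x, llr μ ρ x ∂μ = ∫ x, llr μ ν x ∂μ + ∫ x, llr ν ρ x ∂μ := by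
      rw [← integral_congr_ae hadd]
      exact integral_add hllr hi
    have h₁ := integral_llr_nonneg h hllr
    have h₂ := integral_llr_nonneg (h.trans hνρ) hllr'
    rw [klDiv, klDiv, if_pos ⟨h.trans hνρ, hllr'⟩, if_pos ⟨h, hllr⟩]
    rcases le_total 0 (∫ x, llr ν ρ x ∂μ) with h₃ | h₃
    · rw [ENNReal.ofReal_of_nonpos (neg_nonpos.2 h₃), add_zero, heq, ENNReal.ofReal_add h₁ h₃]
    · rw [ENNReal.ofReal_of_nonpos h₃, add_zero, ← ENNReal.ofReal_add h₂ (neg_nonneg.2 h₃), heq,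
        add_neg_cancel_right]
  · have hllr' : ¬ Integrable (llr μ ρ) μ := fun h' => hllr <|
      (h'.sub hi).congr (by filter_upwards [hadd] with x hx; simp [← hx])
    simp [klDiv, hllr, hllr']

instance isProbabilityMeasure_marg {Θ 𝒴 : Type*} [MeasurableSpace Θ] [MeasurableSpace 𝒴]
    (κ : Kernel Θ 𝒴) [IsMarkovKernel κ] (q : Measure Θ) [IsProbabilityMeasure q] :
    IsProbabilityMeasure (marg κ q) := by
  unfold marg
  infer_instance

lemma klDiv_marg_le {Θ 𝒴 : Type*} [MeasurableSpace Θ] [MeasurableSpace 𝒴]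
    (κ : Kernel Θ 𝒴) [IsMarkovKernel κ] (q p : Measure Θ) [IsProbabilityMeasure q]
    [IsProbabilityMeasure p] : klDiv (marg κ q) (marg κ p) ≤ klDiv q p := by
  rw [klDiv_eq_informationTheory_klDiv, klDiv_eq_informationTheory_klDiv]
  exact InformationTheory.klDiv_comp_right_le q p κ

/-- The compensation identity. No measurability of `θ ↦ KL(κ(θ) ‖ ·)` is needed: the two
integrands differ by the measurable function `θ ↦ ∫ log (d(q∘κ)/d(p∘κ)) dκ(θ)`. -/
lemma EIGaff_eq_EIG_add_klDiv_marg {Θ 𝒴 : Type*} [MeasurableSpace Θ] [MeasurableSpace 𝒴]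
    (κ : Kernel Θ 𝒴) [IsMarkovKernel κ] (q p : Measure Θ) [IsProbabilityMeasure q]
    [IsProbabilityMeasure p] (h : klDiv (marg κ q) (marg κ p) ≠ ⊤) :
    EIGaff κ q p = EIG κ q + klDiv (marg κ q) (marg κ p) := by
  obtain ⟨hac, hllr⟩ : marg κ q ≪ marg κ p ∧
      Integrable (llr (marg κ q) (marg κ p)) (marg κ q) := by
    by_contra hc
    exact h (if_neg hc)
  set f := llr (marg κ q) (marg κ p)
  set H : Θ → ℝ := fun θ => ∫ y, f y ∂κ θ
  have hf : StronglyMeasurable f := stronglyMeasurable_llr _ _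
  have hH : Measurable H := (hf.integral_kernel (κ := κ)).measurable
  have hHint : Integrable H q := by
    have hi := hllr
    rw [marg, Measure.comp_eq_comp_const_apply] at hi
    simpa using hi.integral_comp
  have hHeq : ∫ θ, H θ ∂q = ∫ y, f y ∂marg κ q := by
    have hi := hllr
    rw [marg, Measure.comp_eq_comp_const_apply] at hi
    rw [marg, Measure.comp_eq_comp_const_apply, Kernel.integral_comp hi,
      Kernel.const_apply]
  have hae : ∀ᵐ θ ∂q, klDiv (κ θ) (marg κ p) + ENNReal.ofReal (-H θ) =
      klDiv (κ θ) (marg κ q) + ENNReal.ofReal (H θ) := by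
    filter_upwards [Measure.ae_integrable_of_integrable_comp hllr,
      Measure.ae_ae_of_ae_comp (Measure.rnDeriv_pos hac)] with θ h₁ h₂
    exact klDiv_add_ofReal_neg_integral_llr hac
      (fun h' => absolutelyContinuous_of_ae_rnDeriv_ne_zero h' hac (h₂.mono fun _ hx => hx.ne')) h₁
  have hsum : EIGaff κ q p + ∫⁻ θ, ENNReal.ofReal (-H θ) ∂q =
      EIG κ q + ∫⁻ θ, ENNReal.ofReal (H θ) ∂q := by
    rw [EIGaff, EIG,
      ← lintegral_add_right _ (g := fun θ => ENNReal.ofReal (-H θ)) hH.neg.ennreal_ofReal,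
      ← lintegral_add_right _ hH.ennreal_ofReal]
    exact lintegral_congr_ae hae
  have hneg : ∫⁻ θ, ENNReal.ofReal (-H θ) ∂q ≠ ⊤ := hHint.neg.lintegral_lt_top.ne
  have hpos : ∫⁻ θ, ENNReal.ofReal (H θ) ∂q ≠ ⊤ := hHint.lintegral_lt_top.ne
  have hkl : klDiv (marg κ q) (marg κ p) + ∫⁻ θ, ENNReal.ofReal (-H θ) ∂q =
      ∫⁻ θ, ENNReal.ofReal (H θ) ∂q := by
    have hval : klDiv (marg κ q) (marg κ p) = ENNReal.ofReal (∫ y, f y ∂marg κ q) :=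
      if_pos ⟨hac, hllr⟩
    have h0 : 0 ≤ ∫ y, f y ∂marg κ q := integral_llr_nonneg hac hllr
    have hsub := integral_eq_lintegral_pos_part_sub_lintegral_neg_part hHint
    rw [hHeq] at hsub
    rw [hval, ← ENNReal.ofReal_toReal hneg, ← ENNReal.ofReal_add h0 ENNReal.toReal_nonneg, hsub,
      sub_add_cancel, ENNReal.ofReal_toReal hpos]
  rw [← hkl, ← add_assoc] at hsum
  exact (ENNReal.add_left_inj hneg).1 hsum

/-- Error bound for the robust EIG: `0 ≤ I_ε(p) − I_ε^true(p) ≤ ε`, where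
`I_ε(p) = inf_{q ∈ A_ε(p)} I_aff(q;p)` and `I_ε^true(p) = inf_{q ∈ A_ε(p)} I(q)` over the
KL ambiguity set `A_ε(p) = {q : q ≪ p, KL(q‖p) ≤ ε}`, assuming `I_aff(q;p)` is finite
for every `q` in the ambiguity set. -/
theorem reig_sub_true_reig_le_eps
    {Θ 𝒴 : Type*} [MeasurableSpace Θ] [MeasurableSpace 𝒴]
    (κ : Kernel Θ 𝒴) [IsMarkovKernel κ] (p : Measure Θ) [IsProbabilityMeasure p]
    (ε : ℝ) (hε : 0 ≤ ε)
    (hfin : ∀ q : Measure Θ, IsProbabilityMeasure q → q ≪ p →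
      klDiv q p ≤ ENNReal.ofReal ε → EIGaff κ q p ≠ ⊤) :
    sInf {r : ℝ≥0∞ | ∃ q : Measure Θ, IsProbabilityMeasure q ∧ q ≪ p ∧
        klDiv q p ≤ ENNReal.ofReal ε ∧ r = EIG κ q} ≤
      sInf {r : ℝ≥0∞ | ∃ q : Measure Θ, IsProbabilityMeasure q ∧ q ≪ p ∧
        klDiv q p ≤ ENNReal.ofReal ε ∧ r = EIGaff κ q p} ∧
    sInf {r : ℝ≥0∞ | ∃ q : Measure Θ, IsProbabilityMeasure q ∧ q ≪ p ∧
        klDiv q p ≤ ENNReal.ofReal ε ∧ r = EIGaff κ q p} ≤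
      sInf {r : ℝ≥0∞ | ∃ q : Measure Θ, IsProbabilityMeasure q ∧ q ≪ p ∧
        klDiv q p ≤ ENNReal.ofReal ε ∧ r = EIG κ q} + ENNReal.ofReal ε := by
  have key : ∀ q : Measure Θ, IsProbabilityMeasure q → klDiv q p ≤ ENNReal.ofReal ε →
      EIG κ q ≤ EIGaff κ q p ∧ EIGaff κ q p ≤ EIG κ q + ENNReal.ofReal ε := by
    intro q _ hq
    have hle := (klDiv_marg_le κ q p).trans hq
    rw [EIGaff_eq_EIG_add_klDiv_marg κ q p (ne_top_of_le_ne_top ENNReal.ofReal_ne_top hle)]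
    exact ⟨le_self_add, by gcongr⟩
  constructor
  · refine le_sInf ?_
    rintro _ ⟨q, hq, hqp, hkl, rfl⟩
    exact sInf_le_of_le ⟨q, hq, hqp, hkl, rfl⟩ (key q hq hkl).1
  · rw [← tsub_le_iff_right]
    refine le_sInf ?_
    rintro _ ⟨q, hq, hqp, hkl, rfl⟩
    rw [tsub_le_iff_right]
    exact sInf_le_of_le ⟨q, hq, hqp, hkl, rfl⟩ (key q hq hkl).2
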